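/- arXiv:0807.2371 — 2 statements merged into one kernel-verified Lean document; each statement's English description precedes it below -/
import Mathlib

section
/- Let i+j ≥ n. Then the cone ℝ₊A generated by the exponent set A equals the intersection of the n+1 closed halfspaces determined by ν and the standard basis vectors; explicitly, ℝ₊A = { x ∈ ℝ^n : x_k ≥ 0 for every k ∈ [n], and −j(x_1+⋯+x_i) + (n−j)(x_{i+1}+⋯+x_n) ≥ 0 }. -/
/-- The set of all nonnegative real linear combinations of elements of `S ⊆ ℝ^n`. -/
def nonnegSpan {n : ℕ} (S : Set (Fin n → ℝ)) : Set (Fin n → ℝ) :=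
  { x | ∃ (m : ℕ) (c : Fin m → ℝ) (v : Fin m → (Fin n → ℝ)),
      (∀ l, 0 ≤ c l) ∧ (∀ l, v l ∈ S) ∧ x = ∑ l, c l • v l }

/-- A finite nonnegative combination indexed by any finite type lies in the nonnegative span. -/
theorem sum_smul_mem_nonnegSpan {n : ℕ} {ι : Type*} [Fintype ι] {S : Set (Fin n → ℝ)}
    (c : ι → ℝ) (v : ι → Fin n → ℝ) (hc : ∀ l, 0 ≤ c l) (hv : ∀ l, v l ∈ S) :
    ∑ l, c l • v l ∈ nonnegSpan S := by
  let e := (Fintype.equivFin ι).symm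
  exact ⟨Fintype.card ι, c ∘ e, v ∘ e, fun l => hc _, fun l => hv _,
    (e.sum_comp fun l => c l • v l).symm⟩

/-- The nonnegative span of `S` is contained in every convex cone with apex `0` containing `S`. -/
theorem nonnegSpan_subset {n : ℕ} {S K : Set (Fin n → ℝ)} (hS : S ⊆ K) (h0 : 0 ∈ K)
    (hadd : ∀ x y, x ∈ K → y ∈ K → x + y ∈ K)
    (hsmul : ∀ c : ℝ, 0 ≤ c → ∀ x ∈ K, c • x ∈ K) : nonnegSpan S ⊆ K := by
  rintro _ ⟨m, c, v, hc, hv, rfl⟩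
  exact Finset.sum_induction _ (· ∈ K) hadd h0 fun l _ => hsmul _ (hc l) _ (hS (hv l))

/-- Exactly `j` of the sets `A_k` are equal to `[n] ∖ [i]`. -/
theorem card_filter_constrained {n i j : ℕ} (hi : i ≤ n) (hj : j ≤ n) (hij : n ≤ i + j) :
    (Finset.univ.filter fun k : Fin n => k.val + n < i + j ∨ i ≤ k.val).card = j := by
  have h : (Finset.univ.filter fun k : Fin n => k.val + n < i + j ∨ i ≤ k.val).map
      Fin.valEmbedding = Finset.range (i + j - n) ∪ Finset.Ico i n := by
    ext k
    simp only [Finset.mem_map, Finset.mem_filter, Finset.mem_univ, true_and,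
      Fin.valEmbedding_apply, Finset.mem_union, Finset.mem_range, Finset.mem_Ico]
    constructor
    · rintro ⟨a, ha, rfl⟩
      have := a.isLt
      omega
    · intro hk
      exact ⟨⟨k, by omega⟩, by simp only; omega, rfl⟩
  rw [← Finset.card_map Fin.valEmbedding, h, Finset.card_union_of_disjoint, Finset.card_range,
    Nat.card_Ico]
  · omega
  · rw [Finset.disjoint_left]
    intro k
    simp only [Finset.mem_range, Finset.mem_Ico]
    omega

/-- The fibre cardinalities of the two-valued function equal to `b` on `P` and to `a` off `P`. -/
theorem card_fiber_ite {α β : Type*} [Fintype α] [DecidableEq β] (P : α → Prop)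
    [DecidablePred P] (a b m : β) :
    ((Finset.univ.filter fun k => (if P k then b else a) = m).card : ℝ) =
      ((Fintype.card α : ℝ) - (Finset.univ.filter P).card) * (if a = m then 1 else 0) +
        (Finset.univ.filter P).card * (if b = m then 1 else 0) := by
  have h : ((Finset.univ.filter P).card : ℝ) + (Finset.univ.filter fun k => ¬ P k).card =
      Fintype.card α := by
    exact_mod_cast Finset.card_filter_add_card_filter_not (s := Finset.univ) P
  rw [← h, Finset.card_filter]
  push_cast
  have h' : ∀ k, (if (if P k then b else a) = m then (1 : ℝ) else 0) =
      if P k then (if b = m then 1 else 0) else (if a = m then 1 else 0) := by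
    intro k
    split_ifs <;> rfl
  rw [Finset.sum_congr rfl fun k _ => h' k, Finset.sum_ite, Finset.sum_const, Finset.sum_const]
  simp only [nsmul_eq_mul]
  ring

/-- The total of the fibre cardinalities of `f` over the points satisfying `Q`. -/
theorem sum_card_fiber_filter {α β : Type*} [Fintype α] [Fintype β] [DecidableEq β] (f : α → β)
    (Q : β → Prop) [DecidablePred Q] :
    ∑ m ∈ Finset.univ.filter Q, ((Finset.univ.filter fun k => f k = m).card : ℝ) =
      (Finset.univ.filter fun k => Q (f k)).card := by
  rw [← Nat.cast_sum, Finset.sum_card_fiberwise_eq_card_filter]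
  simp

/-- If `z` sums to `1`, then `p y + q (∑ y) z` is the combination of the vectors `p e_a + q e_b`
with coefficients `y_a z_b`. -/
theorem sum_mul_smul_pair {α : Type*} [Fintype α] [DecidableEq α] (Q : α → Prop)
    [DecidablePred Q] (p q : ℝ) (y z : α → ℝ) (hzQ : ∀ b, ¬ Q b → z b = 0) (hz : ∑ b, z b = 1) :
    ∑ l : α × {b // Q b}, (y l.1 * z l.2) •
        (fun m => p * (if l.1 = m then 1 else 0) + q * (if l.2.1 = m then 1 else 0) : α → ℝ) =
      fun m => p * y m + q * (∑ a, y a) * z m := by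
  have hQ : ∀ g : α → ℝ, (∀ b, ¬ Q b → g b = 0) → ∑ b : {b // Q b}, g b = ∑ b, g b := by
    intro g hg
    rw [← Finset.sum_subtype (Finset.univ.filter Q) (by simp) g]
    exact Finset.sum_subset (Finset.subset_univ _) fun b _ hb => hg b (by simpa using hb)
  funext m
  simp only [Finset.sum_apply, Pi.smul_apply, smul_eq_mul, Fintype.sum_prod_type]
  have hin : ∀ a, ∑ b : {b // Q b}, y a * z b *
      (p * (if a = m then 1 else 0) + q * (if b.1 = m then 1 else 0)) =
      p * (if a = m then y a else 0) + y a * (q * z m) := by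
    intro a
    rw [hQ (fun b => y a * z b *
      (p * (if a = m then 1 else 0) + q * (if b = m then 1 else 0)))
      fun b hb => by simp [hzQ b hb]]
    simp only [mul_add, Finset.sum_add_distrib, ← Finset.sum_mul, ← Finset.mul_sum, hz]
    simp only [mul_ite, mul_one, mul_zero, Finset.sum_ite_eq', Finset.mem_univ, if_true]
    split_ifs <;> ring
  simp only [hin, Finset.sum_add_distrib, ← Finset.mul_sum, ← Finset.sum_mul,
    Finset.sum_ite_eq', Finset.mem_univ, if_true]
  ring

/-- for `i + j ≥ n`, the cone `ℝ₊A` generated by the exponent set `A`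
of the transversal polymatroid presented by `𝒜 = {A_1, …, A_n}` (with
`A_k = [n]∖[i]` for `k ∈ [i+j-n] ∪ ([n]∖[i])` and `A_k = [n]` for
`i+j-n+1 ≤ k ≤ i`; indices 0-based here) equals the intersection of the `n+1`
halfspaces given by the standard basis vectors and `ν = (-j,…,-j, n-j,…,n-j)`. -/
theorem cone_eq_halfspaces_of_le_add
    (n i j : ℕ) (hn : 3 ≤ n) (hi1 : 1 ≤ i) (hi2 : i ≤ n - 2)
    (hj1 : 1 ≤ j) (hj2 : j ≤ n - 1) (hij : n ≤ i + j)
    (A : Set (Fin n → ℝ))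
    (hA : A = { x | ∃ f : Fin n → Fin n,
        (∀ k : Fin n, (k.val + n < i + j ∨ i ≤ k.val) → i ≤ (f k).val) ∧
        ∀ m : Fin n, x m = ((Finset.univ.filter (fun k => f k = m)).card : ℝ) }) :
    nonnegSpan A =
      { x : Fin n → ℝ | (∀ k, 0 ≤ x k) ∧
        0 ≤ -(j : ℝ) * (∑ k ∈ Finset.univ.filter (fun k : Fin n => k.val < i), x k)
            + ((n : ℝ) - j) * (∑ k ∈ Finset.univ.filter (fun k : Fin n => i ≤ k.val), x k) } := by
  subst hA
  have hjn : (j : ℝ) + 1 ≤ n := by exact_mod_cast (by omega : j + 1 ≤ n)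
  have hj0 : (1 : ℝ) ≤ j := by exact_mod_cast hj1
  have hcard := card_filter_constrained (n := n) (i := i) (j := j) (by omega) (by omega) hij
  apply Set.Subset.antisymm
  · apply nonnegSpan_subset
    · rintro x ⟨f, hf, hx⟩
      refine ⟨fun k => by rw [hx]; positivity, ?_⟩
      simp only [hx, sum_card_fiber_filter]
      have hle : (j : ℝ) ≤ (Finset.univ.filter fun k => i ≤ (f k).val).card := by
        exact_mod_cast hcard.symm.le.trans
          (Finset.card_le_card (Finset.monotone_filter_right _ fun k _ => hf k))
      have htot : ((Finset.univ.filter fun k => (f k).val < i).card : ℝ) +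
          (Finset.univ.filter fun k => i ≤ (f k).val).card = n := by
        have := Finset.card_filter_add_card_filter_not (s := Finset.univ)
          fun k => (f k).val < i
        simp only [not_lt, Finset.card_univ, Fintype.card_fin] at this
        exact_mod_cast this
      nlinarith
    · simp
    · rintro x y ⟨hx, hx'⟩ ⟨hy, hy'⟩
      refine ⟨fun k => add_nonneg (hx k) (hy k), ?_⟩
      simp only [Pi.add_apply, Finset.sum_add_distrib]
      linarith
    · rintro c hc x ⟨hx, hx'⟩
      refine ⟨fun k => mul_nonneg hc (hx k), ?_⟩
      simp only [Pi.smul_apply, smul_eq_mul, ← Finset.mul_sum]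
      have := mul_nonneg hc hx'
      linarith
  · rintro x ⟨hx, hx'⟩
    have htot : (∑ k ∈ Finset.univ.filter (fun k : Fin n => k.val < i), x k) +
        ∑ k ∈ Finset.univ.filter (fun k : Fin n => i ≤ k.val), x k = ∑ k, x k := by
      simpa only [not_lt] using
        Finset.sum_filter_add_sum_filter_not Finset.univ (fun k : Fin n => k.val < i) x
    have hL0 : 0 ≤ ∑ k ∈ Finset.univ.filter (fun k : Fin n => k.val < i), x k :=
      Finset.sum_nonneg fun k _ => hx k
    have hH0 : 0 ≤ ∑ k ∈ Finset.univ.filter (fun k : Fin n => i ≤ k.val), x k :=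
      Finset.sum_nonneg fun k _ => hx k
    have hz : ∑ k, (if i ≤ k.val then x k else 0) =
        ∑ k ∈ Finset.univ.filter (fun k : Fin n => i ≤ k.val), x k :=
      (Finset.sum_filter _ _).symm
    set L := ∑ k ∈ Finset.univ.filter (fun k : Fin n => k.val < i), x k
    set H := ∑ k ∈ Finset.univ.filter (fun k : Fin n => i ≤ k.val), x k
    obtain hH | hH := hH0.eq_or_lt
    · have hS : ∑ k, x k = 0 := by nlinarith
      have hx0 : x = 0 := by
        funext k
        exact (Finset.sum_eq_zero_iff_of_nonneg fun k _ => hx k).1 hS k (Finset.mem_univ k)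
      exact ⟨0, Fin.elim0, Fin.elim0, fun l => l.elim0, fun l => l.elim0, by simp [hx0]⟩
    · have hnj : (0 : ℝ) < n - j := by linarith
      have hn0 : (0 : ℝ) < n := by linarith
      let z : Fin n → ℝ := fun k => (if i ≤ k.val then x k else 0) / H
      let y : Fin n → ℝ := fun k => (x k - j * ((L + H) / n) * z k) / (n - j)
      have hz1 : ∑ k, z k = 1 := by
        rw [← Finset.sum_div, hz, div_self hH.ne']
      have hy1 : ∑ k, y k = (L + H) / n := by
        rw [← Finset.sum_div, Finset.sum_sub_distrib, ← Finset.mul_sum, hz1, ← htot]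
        field_simp
      have hz0 : ∀ k, 0 ≤ z k := fun k =>
        div_nonneg (by split_ifs; exacts [hx k, le_rfl]) hH.le
      have hy0 : ∀ k, 0 ≤ y k := by
        intro k
        refine div_nonneg (sub_nonneg.2 ?_) hnj.le
        by_cases hk : i ≤ k.val
        · simp only [z, if_pos hk]
          have h1 : j * ((L + H) / n) ≤ H := by
            rw [← mul_div_assoc, div_le_iff₀ hn0]
            linarith
          calc j * ((L + H) / n) * (x k / H) ≤ H * (x k / H) :=
                mul_le_mul_of_nonneg_right h1 (div_nonneg (hx k) hH.le)
            _ = x k := mul_div_cancel₀ _ hH.ne'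
        · simp [z, hk, hx k]
      have key := sum_mul_smul_pair (fun k : Fin n => i ≤ k.val) (n - j) j y z
        (fun b hb => by simp [z, hb]) hz1
      have hxy : (fun m => ((n : ℝ) - j) * y m + j * (∑ a, y a) * z m) = x := by
        funext m
        rw [hy1, mul_div_cancel₀ _ hnj.ne']
        ring
      rw [← hxy, ← key]
      refine sum_smul_mem_nonnegSpan _ _ (fun l => mul_nonneg (hy0 _) (hz0 _)) fun l => ?_
      refine ⟨fun k => if k.val + n < i + j ∨ i ≤ k.val then l.2.1 else l.1, fun k hk => ?_,
        fun m => ?_⟩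
      · simpa only [if_pos hk] using l.2.2
      · rw [card_fiber_ite, hcard, Fintype.card_fin]
end

section
/- If j = n−i−1, then { β ∈ ℕA : β_k ≥ 1 for every k ∈ [n], and ⟨β,ν⟩ > 0 } = (1,…,1) + ℕA; that is, the exponent set of the canonical module of the base ring K[𝒜] is generated by the single element (1,…,1), so the canonical module is principal and K[𝒜] is a Gorenstein ring. -/
/-- A function with prescribed fibre cardinalities `x` can be chosen to send a given set `C` into a
given set `L`, provided `L` has room for `C`. -/
theorem exists_fun_card_fiber_eq {α β : Type*} [Fintype α] [Fintype β] [DecidableEq α]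
    [DecidableEq β] (x : β → ℕ) (C : Finset α) (L : Finset β)
    (hx : ∑ b, x b = Fintype.card α) (hC : C.card ≤ ∑ b ∈ L, x b) :
    ∃ f : α → β, (∀ a ∈ C, f a ∈ L) ∧
      ∀ b, x b = (Finset.univ.filter (fun a => f a = b)).card := by
  have e₀ : α ≃ (Σ b, Fin (x b)) := Fintype.equivOfCardEq (by simp [hx])
  obtain ⟨T, hT, hTC⟩ := Finset.exists_subset_card_eq
    (s := L.sigma fun b => (Finset.univ : Finset (Fin (x b)))) (n := C.card) (by simpa using hC)
  have e : {p // p ∈ C.map e₀.toEmbedding} ≃ {p // p ∈ T} :=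
    Finset.equivOfCardEq (by simp [hTC])
  let g : α ≃ (Σ b, Fin (x b)) := e₀.trans e.extendSubtype
  refine ⟨fun a => (g a).1, fun a ha => ?_, fun b => ?_⟩
  · exact (Finset.mem_sigma.1 (hT (e.extendSubtype_mem (e₀ a) (by simpa using ha)))).1
  · have h : (Finset.univ.filter (fun a => (g a).1 = b)).card =
        (({b} : Finset β).sigma fun b => (Finset.univ : Finset (Fin (x b)))).card :=
      Finset.card_equiv g (by simp)
    simpa using h.symm

/-- Every `m ≤ ∑ a ∈ s, f a` is attained as the sum over `s` of some `g ≤ f` supported on `s`. -/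
theorem exists_le_sum_eq {α : Type*} [DecidableEq α] (s : Finset α) (f : α → ℕ) (m : ℕ)
    (hm : m ≤ ∑ a ∈ s, f a) :
    ∃ g ≤ f, (∀ a ∉ s, g a = 0) ∧ ∑ a ∈ s, g a = m := by
  induction m with
  | zero => exact ⟨0, fun _ => Nat.zero_le _, by simp, by simp⟩
  | succ m ih =>
    obtain ⟨g, hgf, hgs, hsum⟩ := ih (by omega)
    obtain ⟨a, ha, hlt⟩ := Finset.exists_lt_of_sum_lt (s := s) (f := g) (g := f) (by omega)
    refine ⟨g + Pi.single a 1, fun b => ?_, fun b hb => ?_, ?_⟩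
    · rcases eq_or_ne b a with rfl | h
      · simpa using hlt
      · simpa [h] using hgf b
    · have h : b ≠ a := fun h => hb (h ▸ ha)
      simp [h, hgs b hb]
    · simp [Finset.sum_add_distrib, hsum, ha]

/-- The base of the discrete transversal polymatroid given by a constraint set `C` whose elements
must be sent into `L`. -/
theorem setOf_card_fiber_eq {α : Type*} [Fintype α] [DecidableEq α] (C L : Finset α) :
    {x : α → ℕ | ∃ f : α → α, (∀ a ∈ C, f a ∈ L) ∧
      ∀ b, x b = (Finset.univ.filter (fun a => f a = b)).card} =
    {x | ∑ b, x b = Fintype.card α ∧ C.card ≤ ∑ b ∈ L, x b} := by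
  ext x
  constructor
  · rintro ⟨f, hf, hx⟩
    simp only [Set.mem_ofPred_eq, hx]
    refine ⟨?_, ?_⟩
    · rw [← Finset.card_eq_sum_card_fiberwise (fun _ _ => Finset.mem_coe.2 (Finset.mem_univ _))]
      rfl
    · rw [Finset.card_eq_sum_card_fiberwise hf]
      exact Finset.sum_le_sum fun b _ =>
        Finset.card_le_card (Finset.filter_subset_filter _ (Finset.subset_univ _))
  · rintro ⟨h₁, h₂⟩
    exact exists_fun_card_fiber_eq x C L h₁ h₂

/-- The monoid generated by the vectors with coordinate sum `n` and at least `j` on `L` is normal: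
it is cut out by the homogenized conditions. -/
theorem mem_closure_setOf_sum_eq_iff {α : Type*} [Fintype α] [DecidableEq α] (n j : ℕ)
    (hjn : j ≤ n) (L : Finset α) (β : α → ℕ) :
    β ∈ AddSubmonoid.closure {x : α → ℕ | ∑ b, x b = n ∧ j ≤ ∑ b ∈ L, x b} ↔
      ∃ d, ∑ b, β b = d * n ∧ d * j ≤ ∑ b ∈ L, β b := by
  constructor
  · intro h
    induction h using AddSubmonoid.closure_induction with
    | mem x hx => exact ⟨1, by simpa using hx⟩
    | zero => exact ⟨0, by simp⟩
    | add x y _ _ hx hy =>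
      obtain ⟨d, h₁, h₂⟩ := hx
      obtain ⟨d', h₃, h₄⟩ := hy
      refine ⟨d + d', ?_, ?_⟩ <;> simp only [Pi.add_apply, Finset.sum_add_distrib, add_mul] <;>
        omega
  · rintro ⟨d, h₁, h₂⟩
    induction d generalizing β with
    | zero =>
      have h : β = 0 := by
        ext b
        simpa using (Finset.sum_eq_zero_iff.1 (h₁.trans (zero_mul n))) b (Finset.mem_univ b)
      exact h ▸ zero_mem _
    | succ d ih =>
      rw [add_mul, one_mul] at h₁ h₂
      have hdj : d * j ≤ d * n := Nat.mul_le_mul_left d hjn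
      have hβ := Finset.sum_add_sum_compl L β
      obtain ⟨g, hgβ, hgL, hg⟩ := exists_le_sum_eq L β (min n (∑ b ∈ L, β b - d * j)) (by omega)
      obtain ⟨g', hgβ', hgL', hg'⟩ := exists_le_sum_eq Lᶜ β
        (n - min n (∑ b ∈ L, β b - d * j)) (by omega)
      have hle : g + g' ≤ β := fun b => by
        by_cases hb : b ∈ L
        · simpa [hgL' b (by simpa using hb)] using hgβ b
        · simpa [hgL b hb] using hgβ' b
      have hL : ∑ b ∈ L, (g + g') b = min n (∑ b ∈ L, β b - d * j) := by
        rw [← hg]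
        exact Finset.sum_congr rfl fun b hb => by simp [hgL' b (by simpa using hb)]
      have hLc : ∑ b ∈ Lᶜ, (g + g') b = n - min n (∑ b ∈ L, β b - d * j) := by
        rw [← hg']
        exact Finset.sum_congr rfl fun b hb => by simp [hgL b (by simpa using hb)]
      have hsum := Finset.sum_add_sum_compl L (g + g')
      obtain ⟨δ, rfl⟩ := exists_add_of_le hle
      generalize g + g' = x at *
      simp only [Pi.add_apply, Finset.sum_add_distrib] at *
      refine add_mem (AddSubmonoid.subset_closure ⟨?_, ?_⟩) (ih δ ?_ ?_) <;> omega


theorem card_filter_fin_val_mem_Ico {a b n : ℕ} (h : b ≤ n) :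
    (Finset.univ.filter (fun k : Fin n => a ≤ k.val ∧ k.val < b)).card = b - a := by
  rw [← Nat.card_Ico, ← Finset.card_map Fin.valEmbedding]
  congr 1
  ext m
  simp only [Finset.mem_map, Finset.mem_filter, Finset.mem_univ, true_and, Fin.valEmbedding_apply,
    Finset.mem_Ico]
  exact ⟨by rintro ⟨k, hk, rfl⟩; exact hk, fun hm => ⟨⟨m, by omega⟩, hm, rfl⟩⟩

/-- Gorenstein case: if `j = n-i-1`, then the exponent set of the
canonical module of `K[𝒜]`, `{β ∈ ℕA : β_k ≥ 1 ∀k, ⟨β,ν⟩ > 0}`, equals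
`(1,…,1) + ℕA`; i.e. the canonical module is principal, generated by `x_1⋯x_n`,
so `K[𝒜]` is Gorenstein. -/
theorem canonical_module_principal_of_gorenstein_case
    (n i j : ℕ) (hn : 3 ≤ n) (hi1 : 1 ≤ i) (hi2 : i ≤ n - 2)
    (hj : j = n - i - 1)
    (A : Set (Fin n → ℕ))
    (hA : A = { x | ∃ f : Fin n → Fin n,
        (∀ k : Fin n, (i ≤ k.val ∧ k.val < i + j) → i ≤ (f k).val) ∧
        ∀ m : Fin n, x m = (Finset.univ.filter (fun k => f k = m)).card }) :
    { β : Fin n → ℕ | β ∈ AddSubmonoid.closure A ∧ (∀ k, 1 ≤ β k) ∧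
        0 < -(j : ℤ) * (∑ k ∈ Finset.univ.filter (fun k : Fin n => k.val < i), (β k : ℤ))
            + ((n : ℤ) - j) * (∑ k ∈ Finset.univ.filter (fun k : Fin n => i ≤ k.val), (β k : ℤ)) }
    = { β | ∃ γ ∈ AddSubmonoid.closure A, β = (fun _ => 1) + γ } := by
  have hL : (Finset.univ.filter (fun k : Fin n => i ≤ k.val)).card = j + 1 := by
    have h := card_filter_fin_val_mem_Ico (a := i) (b := n) (n := n) le_rfl
    simp only [Fin.is_lt, and_true] at h
    omega
  have hC : (Finset.univ.filter (fun k : Fin n => i ≤ k.val ∧ k.val < i + j)).card = j := by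
    rw [card_filter_fin_val_mem_Ico (by omega)]
    omega
  have hA' : A = {x | ∑ b, x b = n ∧
      j ≤ ∑ b ∈ Finset.univ.filter (fun k : Fin n => i ≤ k.val), x b} := by
    have h := setOf_card_fiber_eq
      (Finset.univ.filter (fun k : Fin n => i ≤ k.val ∧ k.val < i + j))
      (Finset.univ.filter (fun k : Fin n => i ≤ k.val))
    simp only [Finset.mem_filter, Finset.mem_univ, true_and, Fintype.card_fin, hC] at h
    rw [hA, h]
  have hjn : j ≤ n := by omega
  have hsplit (β : Fin n → ℕ) : ∑ k ∈ Finset.univ.filter (fun k : Fin n => k.val < i), β k +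
      ∑ k ∈ Finset.univ.filter (fun k : Fin n => i ≤ k.val), β k = ∑ k, β k := by
    simpa only [not_lt] using
      Finset.sum_filter_add_sum_filter_not Finset.univ (fun k : Fin n => k.val < i) β
  have hpair (β : Fin n → ℕ) (d : ℕ) (hd : ∑ k, β k = d * n) :
      0 < -(j : ℤ) * (∑ k ∈ Finset.univ.filter (fun k : Fin n => k.val < i), (β k : ℤ))
        + ((n : ℤ) - j) * (∑ k ∈ Finset.univ.filter (fun k : Fin n => i ≤ k.val), (β k : ℤ)) ↔
      d * j < ∑ k ∈ Finset.univ.filter (fun k : Fin n => i ≤ k.val), β k := by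
    have h := hsplit β
    rw [hd] at h
    simp only [← Nat.cast_sum]
    generalize ∑ k ∈ Finset.univ.filter (fun k : Fin n => k.val < i), β k = s at *
    generalize ∑ k ∈ Finset.univ.filter (fun k : Fin n => i ≤ k.val), β k = t at *
    have hs : (s : ℤ) = d * n - t := by
      rw [eq_sub_iff_add_eq]
      exact_mod_cast h
    have hn0 : (0 : ℤ) < n := by omega
    rw [hs, show -(j : ℤ) * (d * n - t) + (n - j) * t = n * (t - d * j) by ring,
      mul_pos_iff_of_pos_left hn0, sub_pos]
    norm_cast
  have hmem := mem_closure_setOf_sum_eq_iff n j hjn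
    (Finset.univ.filter (fun k : Fin n => i ≤ k.val))
  rw [← hA'] at hmem
  ext β
  constructor
  · rintro ⟨hβ, hpos, hν⟩
    obtain ⟨d, h₁, -⟩ := (hmem β).1 hβ
    have h₂ := (hpair β d h₁).1 hν
    obtain ⟨γ, rfl⟩ := exists_add_of_le (show (fun _ => 1) ≤ β from hpos)
    refine ⟨γ, (hmem γ).2 ⟨d - 1, ?_⟩, rfl⟩
    simp only [Pi.add_apply, Finset.sum_add_distrib, Finset.sum_const, Finset.card_univ,
      Fintype.card_fin, smul_eq_mul, mul_one, hL] at h₁ h₂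
    obtain _ | d := d
    · omega
    · rw [add_mul, one_mul] at h₁ h₂
      rw [Nat.add_sub_cancel]
      omega
  · rintro ⟨γ, hγ, rfl⟩
    obtain ⟨d, h₁, h₂⟩ := (hmem γ).1 hγ
    have h₃ : ∑ k, ((fun _ => 1) + γ : Fin n → ℕ) k = (d + 1) * n := by
      simp [Finset.sum_add_distrib, h₁, add_mul, add_comm]
    have h₄ : (d + 1) * j <
        ∑ k ∈ Finset.univ.filter (fun k : Fin n => i ≤ k.val), ((fun _ => 1) + γ : Fin n → ℕ) k := by
      simp only [Pi.add_apply, Finset.sum_add_distrib, Finset.sum_const, smul_eq_mul, mul_one, hL,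
        add_mul, one_mul]
      omega
    exact ⟨(hmem _).2 ⟨d + 1, h₃, h₄.le⟩, fun k => Nat.le_add_right 1 (γ k),
      (hpair _ _ h₃).2 h₄⟩
end
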